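/- arXiv:1706.06708 — 3 statements merged into one kernel-verified Lean document; each statement's English description precedes it below -/
import Mathlib

section
/- Let i ∈ {1, …, n}. Then: (1) for every j ∈ {1, …, m} with lᵢ(j) = 1, bᵢ sends the slot ((h, j, m+i), +x) to ((j, −(m+i), −h), −z) and sends the slot ((−h, j, m+i), −x) to ((j, −(m+i), h), +z); (2) for every j ∈ I such that it is not the case that 1 ≤ j ≤ m and lᵢ(j) = 1, bᵢ sends the slot ((h, j, m+i), +x) to ((j, −h, m+i), −y) and sends the slot ((−h, j, m+i), −x) to ((j, h, m+i), +y); (3) bᵢ fixes every other surface slot whose direction is +x or −x. -/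
namespace RC

/-- The six signed coordinate directions. -/
inductive Dir : Type
  | xp | xn | yp | yn | zp | zn
  deriving DecidableEq

/-- Nonzero slice coordinates of absolute value at most `h`. -/
def I (h : ℕ) : Type := {i : ℤ // i ≠ 0 ∧ |i| ≤ (h : ℤ)}

instance (h : ℕ) : DecidableEq (I h) :=
  inferInstanceAs (DecidableEq {i : ℤ // i ≠ 0 ∧ |i| ≤ (h : ℤ)})

instance (h : ℕ) : Neg (I h) :=
  ⟨fun i => ⟨-i.1, neg_ne_zero.mpr i.2.1, by rw [abs_neg]; exact i.2.2⟩⟩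

@[simp] theorem I.neg_neg {h : ℕ} (i : I h) : -(-i) = i :=
  Subtype.ext (by show -(-i.1) = i.1; exact _root_.neg_neg i.1)

/-- Sticker slots of the cube: a cubie position together with a face direction. -/
abbrev S (h : ℕ) : Type := (I h × I h × I h) × Dir

/-- Rotation of directions by a clockwise `x` turn: fixes `±x`,
`+y ↦ −z ↦ −y ↦ +z ↦ +y`. -/
def rotX : Dir → Dir
  | .xp => .xp | .xn => .xn | .yp => .zn | .zn => .yn | .yn => .zp | .zp => .yp

def rotXi : Dir → Dir
  | .xp => .xp | .xn => .xn | .zn => .yp | .yn => .zn | .zp => .yn | .yp => .zp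

/-- Rotation of directions by a clockwise `y` turn: fixes `±y`,
`+z ↦ −x ↦ −z ↦ +x ↦ +z`. -/
def rotY : Dir → Dir
  | .yp => .yp | .yn => .yn | .zp => .xn | .xn => .zn | .zn => .xp | .xp => .zp

def rotYi : Dir → Dir
  | .yp => .yp | .yn => .yn | .xn => .zp | .zn => .xn | .xp => .zn | .zp => .xp

/-- Rotation of directions by a clockwise `z` turn: fixes `±z`,
`+x ↦ −y ↦ −x ↦ +y ↦ +x`. -/
def rotZ : Dir → Dir
  | .zp => .zp | .zn => .zn | .xp => .yn | .yn => .xn | .xn => .yp | .yp => .xp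

def rotZi : Dir → Dir
  | .zp => .zp | .zn => .zn | .yn => .xp | .xn => .yn | .yp => .xn | .xp => .yp

@[simp] theorem rotXi_rotX (d : Dir) : rotXi (rotX d) = d := by cases d <;> rfl
@[simp] theorem rotX_rotXi (d : Dir) : rotX (rotXi d) = d := by cases d <;> rfl
@[simp] theorem rotYi_rotY (d : Dir) : rotYi (rotY d) = d := by cases d <;> rfl
@[simp] theorem rotY_rotYi (d : Dir) : rotY (rotYi d) = d := by cases d <;> rfl
@[simp] theorem rotZi_rotZ (d : Dir) : rotZi (rotZ d) = d := by cases d <;> rfl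
@[simp] theorem rotZ_rotZi (d : Dir) : rotZ (rotZi d) = d := by cases d <;> rfl

/-- Clockwise quarter turn of the `x = v` slice (as seen from positive `x`). -/
def X {h : ℕ} (v : I h) : Equiv.Perm (S h) where
  toFun s := if s.1.1 = v then ((s.1.1, s.1.2.2, -s.1.2.1), rotX s.2) else s
  invFun s := if s.1.1 = v then ((s.1.1, -s.1.2.2, s.1.2.1), rotXi s.2) else s
  left_inv := by
    rintro ⟨⟨x, y, z⟩, d⟩
    by_cases hx : x = v <;> simp [hx]
  right_inv := by
    rintro ⟨⟨x, y, z⟩, d⟩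
    by_cases hx : x = v <;> simp [hx]

/-- Clockwise quarter turn of the `y = v` slice (as seen from positive `y`). -/
def Y {h : ℕ} (v : I h) : Equiv.Perm (S h) where
  toFun s := if s.1.2.1 = v then ((-s.1.2.2, s.1.2.1, s.1.1), rotY s.2) else s
  invFun s := if s.1.2.1 = v then ((s.1.2.2, s.1.2.1, -s.1.1), rotYi s.2) else s
  left_inv := by
    rintro ⟨⟨x, y, z⟩, d⟩
    by_cases hy : y = v <;> simp [hy]
  right_inv := by
    rintro ⟨⟨x, y, z⟩, d⟩
    by_cases hy : y = v <;> simp [hy]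

/-- Clockwise quarter turn of the `z = v` slice (as seen from positive `z`). -/
def Z {h : ℕ} (v : I h) : Equiv.Perm (S h) where
  toFun s := if s.1.2.2 = v then ((s.1.2.1, -s.1.1, s.1.2.2), rotZ s.2) else s
  invFun s := if s.1.2.2 = v then ((-s.1.2.1, s.1.1, s.1.2.2), rotZi s.2) else s
  left_inv := by
    rintro ⟨⟨x, y, z⟩, d⟩
    by_cases hz : z = v <;> simp [hz]
  right_inv := by
    rintro ⟨⟨x, y, z⟩, d⟩
    by_cases hz : z = v <;> simp [hz]

/-- The side-length parameter: `h = m + 3n`. -/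
abbrev hC (n m : ℕ) : ℕ := m + 3 * n

def bit {m : ℕ} (w : Fin m → Bool) (c : ℤ) : Bool :=
  if hc : 1 ≤ c ∧ c ≤ (m : ℤ) then w ⟨(c - 1).toNat, by omega⟩ else false

/-- The `x`-slice index corresponding to bit position `j`. -/
def colIdx {n m : ℕ} (j : Fin m) : I (hC n m) :=
  ⟨((j : ℕ) : ℤ) + 1, by
    have hj : (j : ℕ) < m := j.isLt
    constructor
    · omega
    · rw [abs_of_nonneg (by omega)]; push_cast; omega⟩

/-- The `z`-slice index `m + i` corresponding to row `i`. -/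
def zIdx {n m : ℕ} (i : Fin n) : I (hC n m) :=
  ⟨(m : ℤ) + ((i : ℕ) : ℤ) + 1, by
    have hi : (i : ℕ) < n := i.isLt
    constructor
    · omega
    · rw [abs_of_nonneg (by omega)]; push_cast; omega⟩

/-- The face coordinate `h`. -/
def topI {n m : ℕ} (H : 0 < m + 3 * n) : I (hC n m) :=
  ⟨(m : ℤ) + 3 * (n : ℤ), by
    constructor
    · omega
    · rw [abs_of_nonneg (by omega)]; push_cast; omega⟩

/-- `aᵢ := (X 1)^{lᵢ(1)} ⋯ (X m)^{lᵢ(m)}`. -/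
def a {n m : ℕ} (l : Fin n → Fin m → Bool) (i : Fin n) : Equiv.Perm (S (hC n m)) :=
  ((List.finRange m).map (fun j => X (colIdx (n := n) j) ^ (if l i j then 1 else 0))).prod

/-- `bᵢ := aᵢ⁻¹ · (Z (m+i)) · aᵢ`. -/
def b {n m : ℕ} (l : Fin n → Fin m → Bool) (i : Fin n) : Equiv.Perm (S (hC n m)) :=
  (a l i)⁻¹ * Z (zIdx (m := m) i) * a l i

/-- `t := a₁ · b₁ · b₂ ⋯ bₙ`. -/
def t {n m : ℕ} (hn : 0 < n) (l : Fin n → Fin m → Bool) : Equiv.Perm (S (hC n m)) :=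
  a l ⟨0, hn⟩ * ((List.finRange n).map (b l)).prod

/-- A slot is a surface slot if its cubie is on the face its direction points to. -/
def IsSurface {h : ℕ} (s : S h) : Prop :=
  match s.2 with
  | .xp => s.1.1.1 = (h : ℤ)
  | .xn => s.1.1.1 = -(h : ℤ)
  | .yp => s.1.2.1.1 = (h : ℤ)
  | .yn => s.1.2.1.1 = -(h : ℤ)
  | .zp => s.1.2.2.1 = (h : ℤ)
  | .zn => s.1.2.2.1 = -(h : ℤ)

/-- An STM move: a nontrivial rotation of a single slice. -/
def IsSTM {h : ℕ} (g : Equiv.Perm (S h)) : Prop :=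
  ∃ (v : I h) (e : ℕ), (e = 1 ∨ e = 2 ∨ e = 3) ∧
    (g = X v ^ e ∨ g = Y v ^ e ∨ g = Z v ^ e)


theorem X_apply_of_eq {h : ℕ} {v x : I h} (hx : x = v) (y z : I h) (d : Dir) :
    X v ((x, y, z), d) = ((x, z, -y), rotX d) := by
  simp [X, hx]

theorem X_apply_of_ne {h : ℕ} {v : I h} {s : S h} (hs : s.1.1 ≠ v) : X v s = s := by
  simp [X, hs]

theorem X_apply_fst {h : ℕ} (v : I h) (s : S h) : (X v s).1.1 = s.1.1 := by
  by_cases hs : s.1.1 = v <;> simp [X, hs]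

theorem Z_apply_of_eq {h : ℕ} {v z : I h} (hz : z = v) (x y : I h) (d : Dir) :
    Z v ((x, y, z), d) = ((y, -x, z), rotZ d) := by
  simp [Z, hz]

theorem Z_apply_of_ne {h : ℕ} {v : I h} {s : S h} (hs : s.1.2.2 ≠ v) : Z v s = s := by
  simp [Z, hs]

theorem colIdx_injective {n m : ℕ} : Function.Injective (colIdx (n := n) (m := m)) := by
  intro j k hjk
  have h1 : ((j : ℕ) : ℤ) + 1 = ((k : ℕ) : ℤ) + 1 := congrArg Subtype.val hjk
  exact Fin.ext (by omega)

/-- A product of column turns fixes every slot outside the turned columns. -/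
theorem prod_X_apply_of_forall_ne {n m : ℕ} (w : Fin m → Bool) (L : List (Fin m))
    (s : S (hC n m)) (hs : ∀ j ∈ L, w j = true → s.1.1 ≠ colIdx j) :
    (L.map fun j => X (colIdx (n := n) j) ^ (if w j then 1 else 0)).prod s = s := by
  induction L with
  | nil => simp
  | cons k L ih =>
    rw [List.map_cons, List.prod_cons, Equiv.Perm.mul_apply,
      ih fun j hj => hs j (List.mem_cons_of_mem _ hj)]
    by_cases hk : w k = true
    · simpa [hk] using X_apply_of_ne (hs k List.mem_cons_self hk)
    · simp [hk]

/-- A product of distinct column turns acts on each turned column by the turn of that column. -/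
theorem prod_X_apply_of_mem {n m : ℕ} (w : Fin m → Bool) (L : List (Fin m)) (hL : L.Nodup)
    (s : S (hC n m)) (j : Fin m) (hj : j ∈ L) (hw : w j = true) (hs : s.1.1 = colIdx j) :
    (L.map fun j => X (colIdx (n := n) j) ^ (if w j then 1 else 0)).prod s =
      X (colIdx j) s := by
  induction L with
  | nil => simp at hj
  | cons k L ih =>
    rw [List.nodup_cons] at hL
    rw [List.map_cons, List.prod_cons, Equiv.Perm.mul_apply]
    by_cases hjk : j = k
    · subst hjk
      rw [prod_X_apply_of_forall_ne]
      · simp [hw]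
      · intro k hk _ hsk
        exact hL.1 (colIdx_injective (hs.symm.trans hsk) ▸ hk)
    · rw [ih hL.2 ((List.mem_cons.mp hj).resolve_left hjk)]
      by_cases hk : w k = true
      · have hne : (X (colIdx j) s).1.1 ≠ colIdx k := by
          rw [X_apply_fst, hs]
          exact fun h => hjk (colIdx_injective h)
        simpa [hk] using X_apply_of_ne hne
      · simp [hk]

theorem a_apply_of_forall_ne {n m : ℕ} (l : Fin n → Fin m → Bool) (i : Fin n)
    (s : S (hC n m)) (hs : ∀ j, l i j = true → s.1.1 ≠ colIdx j) : a l i s = s :=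
  prod_X_apply_of_forall_ne (l i) _ s fun j _ => hs j

theorem a_apply_of_eq {n m : ℕ} (l : Fin n → Fin m → Bool) (i : Fin n) (s : S (hC n m))
    (j : Fin m) (hl : l i j = true) (hs : s.1.1 = colIdx j) : a l i s = X (colIdx j) s :=
  prod_X_apply_of_mem (l i) _ (List.nodup_finRange m) s j (List.mem_finRange j) hl hs

theorem topI_ne_colIdx {n m : ℕ} (H : 0 < m + 3 * n) (hn : 0 < n) (j : Fin m) :
    topI H ≠ colIdx (n := n) j := by
  intro h
  have h1 : (m : ℤ) + 3 * (n : ℤ) = ((j : ℕ) : ℤ) + 1 := congrArg Subtype.val h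
  omega

theorem neg_topI_ne_colIdx {n m : ℕ} (H : 0 < m + 3 * n) (j : Fin m) :
    -topI H ≠ colIdx (n := n) j := by
  intro h
  have h1 : -((m : ℤ) + 3 * (n : ℤ)) = ((j : ℕ) : ℤ) + 1 := congrArg Subtype.val h
  omega

theorem bit_colIdx {n m : ℕ} (w : Fin m → Bool) (j : Fin m) :
    bit w (colIdx (n := n) j).1 = w j := by
  simp [bit, colIdx]

theorem exists_colIdx_of_bit {n m : ℕ} {w : Fin m → Bool} {c : I (hC n m)}
    (hc : bit w c.1 = true) : ∃ j : Fin m, w j = true ∧ c = colIdx j := by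
  unfold bit at hc
  split_ifs at hc with hr
  exact ⟨_, hc, Subtype.ext (by simp only [colIdx]; omega)⟩

theorem b_apply_of_eq {n m : ℕ} (l : Fin n → Fin m → Bool) (i : Fin n) {s u : S (hC n m)}
    (hs : a l i s = s) (hu : a l i u = Z (zIdx i) s) : b l i s = u := by
  rw [b, Equiv.Perm.mul_apply, Equiv.Perm.mul_apply, hs, Equiv.Perm.inv_eq_iff_eq, hu]

/-- the effect of `bᵢ` on the `±x` surface slots. -/
theorem stmt_14 (n m : ℕ) (hn : 0 < n) (hm : 0 < m) (l : Fin n → Fin m → Bool)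
    (i : Fin n) :
    (∀ j : Fin m, l i j = true →
      b l i ((topI (by omega), colIdx (n := n) j, zIdx (m := m) i), Dir.xp) =
        ((colIdx (n := n) j, -(zIdx (m := m) i), -(topI (by omega))), Dir.zn) ∧
      b l i ((-(topI (by omega)), colIdx (n := n) j, zIdx (m := m) i), Dir.xn) =
        ((colIdx (n := n) j, -(zIdx (m := m) i), topI (by omega)), Dir.zp)) ∧
    (∀ j : I (hC n m), bit (l i) j.1 = false →
      b l i ((topI (by omega), j, zIdx (m := m) i), Dir.xp) =
        ((j, -(topI (by omega)), zIdx (m := m) i), Dir.yn) ∧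
      b l i ((-(topI (by omega)), j, zIdx (m := m) i), Dir.xn) =
        ((j, topI (by omega), zIdx (m := m) i), Dir.yp)) ∧
    (∀ s : S (hC n m), IsSurface s → (s.2 = Dir.xp ∨ s.2 = Dir.xn) →
      ¬(∃ j : Fin m, l i j = true ∧
        (s = ((topI (by omega), colIdx (n := n) j, zIdx (m := m) i), Dir.xp) ∨
         s = ((-(topI (by omega)), colIdx (n := n) j, zIdx (m := m) i), Dir.xn))) →
      ¬(∃ j : I (hC n m), bit (l i) j.1 = false ∧
        (s = ((topI (by omega), j, zIdx (m := m) i), Dir.xp) ∨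
         s = ((-(topI (by omega)), j, zIdx (m := m) i), Dir.xn))) →
      b l i s = s) := by
  have hp (d : Dir) (y z : I (hC n m)) :
      a l i ((topI (by omega), y, z), d) = ((topI (by omega), y, z), d) :=
    a_apply_of_forall_ne l i _ fun k _ => topI_ne_colIdx (by omega) hn k
  have hq (d : Dir) (y z : I (hC n m)) :
      a l i ((-topI (by omega), y, z), d) = ((-topI (by omega), y, z), d) :=
    a_apply_of_forall_ne l i _ fun k _ => neg_topI_ne_colIdx (by omega) k
  refine ⟨fun j hj => ⟨?_, ?_⟩, fun j hj => ⟨?_, ?_⟩, ?_⟩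
  · apply b_apply_of_eq l i (hp _ _ _)
    rw [a_apply_of_eq l i _ j hj rfl, X_apply_of_eq rfl, Z_apply_of_eq rfl, I.neg_neg]
    rfl
  · apply b_apply_of_eq l i (hq _ _ _)
    rw [a_apply_of_eq l i _ j hj rfl, X_apply_of_eq rfl, Z_apply_of_eq rfl, I.neg_neg, I.neg_neg]
    rfl
  · apply b_apply_of_eq l i (hp _ _ _)
    rw [a_apply_of_forall_ne, Z_apply_of_eq rfl]
    · rfl
    · rintro k hk rfl
      simp [bit_colIdx, hk] at hj
  · apply b_apply_of_eq l i (hq _ _ _)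
    rw [a_apply_of_forall_ne, Z_apply_of_eq rfl, I.neg_neg]
    · rfl
    · rintro k hk rfl
      simp [bit_colIdx, hk] at hj
  · rintro ⟨⟨x, y, z⟩, d⟩ hsurf hd h1 h2
    have hx : (x = topI (by omega) ∧ d = Dir.xp) ∨ (x = -topI (by omega) ∧ d = Dir.xn) := by
      rcases hd with rfl | rfl
      · exact .inl ⟨Subtype.ext (hsurf.trans (by simp [topI])), rfl⟩
      · refine .inr ⟨Subtype.ext (hsurf.trans ?_), rfl⟩
        change -((m + 3 * n : ℕ) : ℤ) = -((m : ℤ) + 3 * (n : ℤ))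
        push_cast
        rfl
    have hfix : a l i ((x, y, z), d) = ((x, y, z), d) := by
      rcases hx with ⟨rfl, rfl⟩ | ⟨rfl, rfl⟩
      · exact hp _ _ _
      · exact hq _ _ _
    apply b_apply_of_eq l i hfix
    rw [hfix, Z_apply_of_ne]
    rintro rfl
    cases hb : bit (l i) y.1 with
    | false => exact h2 ⟨y, hb, hx.imp (by rintro ⟨rfl, rfl⟩; rfl) (by rintro ⟨rfl, rfl⟩; rfl)⟩
    | true =>
      obtain ⟨j, hj, rfl⟩ := exists_colIdx_of_bit hb
      exact h1 ⟨j, hj, hx.imp (by rintro ⟨rfl, rfl⟩; rfl) (by rintro ⟨rfl, rfl⟩; rfl)⟩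

end RC
end

section
/- Let b := b₁ · b₂ ⋯ bₙ. For every surface slot p of S, write d′ for the direction component of b⁻¹(p). Then: (1) if p = ((x, y, h), +z), then d′ = −x (red) if there exist i ∈ {1, …, n} and j ∈ {1, …, m} with (x, y) = (j, −(m+i)) and lᵢ(j) = 1, and d′ = +z (white) otherwise; (2) if p = ((x, y, −h), −z), then d′ = +x (orange) if there exist such i, j with (x, y) = (j, −(m+i)) and lᵢ(j) = 1, and d′ = −z (blue) otherwise; (3) if p = ((x, h, z), +y), then d′ = −x (red) if there exists i ∈ {1, …, n} with z = m+i and it is not the case that 1 ≤ x ≤ m and lᵢ(x) = 1, and d′ = +y (green) otherwise; (4) if p = ((x, −h, z), −y), then d′ = +x (orange) if there exists i ∈ {1, …, n} with z = m+i and it is not the case that 1 ≤ x ≤ m and lᵢ(x) = 1, and d′ = −y (yellow) otherwise; (5) if p = ((h, y, z), +x), then d′ = +z (white) if there exist i ∈ {1, …, n} and j ∈ {1, …, m} with (y, z) = (−j, m+i) and lᵢ(j) = 1, d′ = +y (green) if z = m+i for some i ∈ {1, …, n} but no such i, j exist, and d′ = +x (orange) otherwise; (6) if p = ((−h, y, z),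 −x), then d′ = −z (blue) if there exist i ∈ {1, …, n} and j ∈ {1, …, m} with (y, z) = (−j, m+i) and lᵢ(j) = 1, d′ = −y (yellow) if z = m+i for some i ∈ {1, …, n} but no such i, j exist, and d′ = −x (red) otherwise. -/
namespace RC

/-- `b := b₁ · b₂ ⋯ bₙ`. -/
def bprod {n m : ℕ} (l : Fin n → Fin m → Bool) : Equiv.Perm (S (hC n m)) :=
  ((List.finRange n).map (b l)).prod

theorem I.ext_val {h : ℕ} {i j : I h} : i = j ↔ i.1 = j.1 := Subtype.ext_iff

@[simp] theorem I.neg_val {h : ℕ} (i : I h) : (-i).1 = -i.1 := rfl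

@[simp] theorem colIdx_val {n m : ℕ} (j : Fin m) :
    (colIdx (n := n) j).1 = ((j : ℕ) : ℤ) + 1 := rfl

@[simp] theorem zIdx_val {n m : ℕ} (i : Fin n) :
    (zIdx (m := m) i).1 = (m : ℤ) + ((i : ℕ) : ℤ) + 1 := rfl

@[simp] theorem topI_val {n m : ℕ} (H : 0 < m + 3 * n) :
    (topI H).1 = (m : ℤ) + 3 * (n : ℤ) := rfl

theorem bit_eq_false {m : ℕ} (w : Fin m → Bool) {c : ℤ} (hc : c < 1 ∨ (m : ℤ) < c) :
    bit w c = false := by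
  unfold bit
  rw [dif_neg (by omega)]

theorem bit_eq_true_iff {n m : ℕ} (w : Fin m → Bool) (x : I (hC n m)) :
    bit w x.1 = true ↔ ∃ j : Fin m, x = colIdx (n := n) j ∧ w j = true := by
  constructor
  · intro hx
    by_cases hc : 1 ≤ x.1 ∧ x.1 ≤ (m : ℤ)
    · rw [bit, dif_pos hc] at hx
      refine ⟨_, I.ext_val.2 ?_, hx⟩
      simp only [colIdx_val]
      omega
    · rw [bit, dif_neg hc] at hx
      cases hx
  · rintro ⟨j, rfl, hj⟩
    have := j.isLt
    rw [bit, dif_pos (by simp only [colIdx_val]; omega)]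
    convert hj
    simp

theorem X_apply {h : ℕ} (v x y z : I h) (d : Dir) :
    X v ((x, y, z), d) = if x = v then ((x, z, -y), rotX d) else ((x, y, z), d) := rfl

theorem Z_apply {h : ℕ} (v x y z : I h) (d : Dir) :
    Z v ((x, y, z), d) = if z = v then ((y, -x, z), rotZ d) else ((x, y, z), d) := rfl

theorem prod_X_apply {n m : ℕ} (w : Fin m → Bool) (L : List (Fin m)) (hL : L.Nodup)
    (x y z : I (hC n m)) (d : Dir) :
    (L.map (fun j => X (colIdx (n := n) j) ^ (if w j then 1 else 0))).prod ((x, y, z), d) =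
      if ∃ j ∈ L, x = colIdx (n := n) j ∧ w j = true then ((x, z, -y), rotX d)
      else ((x, y, z), d) := by
  induction L with
  | nil => simp
  | cons j L ih =>
    obtain ⟨hj, hL⟩ := List.nodup_cons.1 hL
    rw [List.map_cons, List.prod_cons, Equiv.Perm.mul_apply, ih hL]
    by_cases hx : x = colIdx j ∧ w j = true
    · have hnot : ¬∃ k ∈ L, x = colIdx (n := n) k ∧ w k = true := by
        rintro ⟨k, hk, hxk, -⟩
        have hjk : k = j := by
          have := I.ext_val.1 (hxk.symm.trans hx.1)
          simp only [colIdx_val] at this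
          omega
        exact hj (hjk ▸ hk)
      have hex : ∃ k ∈ j :: L, x = colIdx (n := n) k ∧ w k = true :=
        ⟨j, List.mem_cons_self, hx⟩
      rw [if_neg hnot, if_pos hex, if_pos hx.2, pow_one, X_apply, if_pos hx.1]
    · have hfix : ∀ (y z : I (hC n m)) (d : Dir),
          (X (colIdx (n := n) j) ^ (if w j then 1 else 0)) ((x, y, z), d) = ((x, y, z), d) := by
        intro y z d
        by_cases hw : w j = true
        · rw [if_pos hw, pow_one, X_apply, if_neg fun h => hx ⟨h, hw⟩]
        · rw [if_neg hw, pow_zero, Equiv.Perm.one_apply]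
      have hiff : (∃ k ∈ j :: L, x = colIdx (n := n) k ∧ w k = true) ↔
          ∃ k ∈ L, x = colIdx (n := n) k ∧ w k = true := by
        simp [hx]
      by_cases hex : ∃ k ∈ L, x = colIdx (n := n) k ∧ w k = true
      · rw [if_pos hex, if_pos (hiff.2 hex), hfix]
      · rw [if_neg hex, if_neg (hiff.not.2 hex), hfix]

theorem a_apply {n m : ℕ} (l : Fin n → Fin m → Bool) (i : Fin n) (x y z : I (hC n m)) (d : Dir) :
    a l i ((x, y, z), d) =
      if bit (l i) x.1 = true then ((x, z, -y), rotX d) else ((x, y, z), d) := by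
  rw [a, prod_X_apply _ _ (List.nodup_finRange m)]
  simp [bit_eq_true_iff]

/-- The cubie position `c` is not brought into the slice `z = m + i` by `aᵢ`, so `bᵢ` fixes it. -/
def Avoids {n m : ℕ} (l : Fin n → Fin m → Bool) (i : Fin n)
    (c : I (hC n m) × I (hC n m) × I (hC n m)) : Prop :=
  if bit (l i) c.1.1 = true then -c.2.1 ≠ zIdx (m := m) i else c.2.2 ≠ zIdx (m := m) i

theorem b_apply_of_avoids {n m : ℕ} {l : Fin n → Fin m → Bool} {i : Fin n} {s : S (hC n m)}
    (hs : Avoids l i s.1) : b l i s = s := by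
  obtain ⟨⟨x, y, z⟩, d⟩ := s
  rw [b, Equiv.Perm.mul_apply, Equiv.Perm.mul_apply, Equiv.Perm.inv_eq_iff_eq, a_apply]
  unfold Avoids at hs
  split_ifs at hs ⊢ <;> rw [Z_apply, if_neg hs]

theorem prod_map_apply_eq_self {α ι : Type*} (f : ι → Equiv.Perm α) (L : List ι) {s : α}
    (hs : ∀ k ∈ L, f k s = s) : (L.map f).prod s = s := by
  induction L with
  | nil => rfl
  | cons k L ih =>
    rw [List.map_cons, List.prod_cons, Equiv.Perm.mul_apply,
      ih fun j hj => hs j (List.mem_cons_of_mem _ hj), hs k List.mem_cons_self]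

theorem prod_map_apply_eq {α ι : Type*} (f : ι → Equiv.Perm α) (L : List ι) (hL : L.Nodup)
    {i : ι} (hi : i ∈ L) {s s' : α} (hf : f i s' = s) (hs : ∀ k ≠ i, f k s = s)
    (hs' : ∀ k ≠ i, f k s' = s') : (L.map f).prod s' = s := by
  obtain ⟨A, B, rfl⟩ := List.append_of_mem hi
  have hmem := List.nodup_middle.1 hL |> List.nodup_cons.1 |>.1
  rw [List.mem_append, not_or] at hmem
  rw [List.map_append, List.prod_append, List.map_cons, List.prod_cons, Equiv.Perm.mul_apply,
    Equiv.Perm.mul_apply,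
    prod_map_apply_eq_self f B fun k hk => hs' k fun h => hmem.2 (h ▸ hk), hf,
    prod_map_apply_eq_self f A fun k hk => hs k fun h => hmem.1 (h ▸ hk)]

theorem bprod_inv_apply_of_avoids {n m : ℕ} {l : Fin n → Fin m → Bool} {s : S (hC n m)}
    (hs : ∀ k, Avoids l k s.1) : (bprod l)⁻¹ s = s := by
  rw [Equiv.Perm.inv_eq_iff_eq, bprod,
    prod_map_apply_eq_self _ _ fun k _ => b_apply_of_avoids (hs k)]

theorem bprod_inv_apply {n m : ℕ} {l : Fin n → Fin m → Bool} (i : Fin n) {s : S (hC n m)}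
    (s' : S (hC n m)) (hi : Z (zIdx (m := m) i) (a l i s') = a l i s)
    (hs : ∀ k ≠ i, Avoids l k s.1) (hs' : ∀ k ≠ i, Avoids l k s'.1) : (bprod l)⁻¹ s = s' := by
  rw [Equiv.Perm.inv_eq_iff_eq, bprod, eq_comm]
  refine prod_map_apply_eq _ _ (List.nodup_finRange n) (List.mem_finRange i) ?_
    (fun k hk => b_apply_of_avoids (hs k hk)) fun k hk => b_apply_of_avoids (hs' k hk)
  rw [b, Equiv.Perm.mul_apply, Equiv.Perm.mul_apply, Equiv.Perm.inv_eq_iff_eq, hi]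

theorem avoids_of {n m : ℕ} {l : Fin n → Fin m → Bool} {i : Fin n} {x y z : I (hC n m)}
    (hy : bit (l i) x.1 = true → -y.1 ≠ (m : ℤ) + ((i : ℕ) : ℤ) + 1)
    (hz : bit (l i) x.1 = false → z.1 ≠ (m : ℤ) + ((i : ℕ) : ℤ) + 1) :
    Avoids l i (x, y, z) := by
  unfold Avoids
  split_ifs with hb
  · exact fun h => hy hb (I.ext_val.1 h)
  · exact fun h => hz (by simpa using hb) (I.ext_val.1 h)

/-- the coloring of the configuration `b(C₀)`. -/
theorem stmt_15 (n m : ℕ) (hn : 0 < n) (hm : 0 < m) (l : Fin n → Fin m → Bool) :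
    (∀ x y : I (hC n m),
      ((∃ (i : Fin n) (j : Fin m),
          x = colIdx (n := n) j ∧ y = -(zIdx (m := m) i) ∧ l i j = true) →
        ((bprod l)⁻¹ ((x, y, topI (by omega)), Dir.zp)).2 = Dir.xn) ∧
      (¬(∃ (i : Fin n) (j : Fin m),
          x = colIdx (n := n) j ∧ y = -(zIdx (m := m) i) ∧ l i j = true) →
        ((bprod l)⁻¹ ((x, y, topI (by omega)), Dir.zp)).2 = Dir.zp)) ∧
    (∀ x y : I (hC n m),
      ((∃ (i : Fin n) (j : Fin m),
          x = colIdx (n := n) j ∧ y = -(zIdx (m := m) i) ∧ l i j = true) →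
        ((bprod l)⁻¹ ((x, y, -(topI (by omega))), Dir.zn)).2 = Dir.xp) ∧
      (¬(∃ (i : Fin n) (j : Fin m),
          x = colIdx (n := n) j ∧ y = -(zIdx (m := m) i) ∧ l i j = true) →
        ((bprod l)⁻¹ ((x, y, -(topI (by omega))), Dir.zn)).2 = Dir.zn)) ∧
    (∀ x z : I (hC n m),
      ((∃ i : Fin n, z = zIdx (m := m) i ∧ bit (l i) x.1 = false) →
        ((bprod l)⁻¹ ((x, topI (by omega), z), Dir.yp)).2 = Dir.xn) ∧
      (¬(∃ i : Fin n, z = zIdx (m := m) i ∧ bit (l i) x.1 = false) →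
        ((bprod l)⁻¹ ((x, topI (by omega), z), Dir.yp)).2 = Dir.yp)) ∧
    (∀ x z : I (hC n m),
      ((∃ i : Fin n, z = zIdx (m := m) i ∧ bit (l i) x.1 = false) →
        ((bprod l)⁻¹ ((x, -(topI (by omega)), z), Dir.yn)).2 = Dir.xp) ∧
      (¬(∃ i : Fin n, z = zIdx (m := m) i ∧ bit (l i) x.1 = false) →
        ((bprod l)⁻¹ ((x, -(topI (by omega)), z), Dir.yn)).2 = Dir.yn)) ∧
    (∀ y z : I (hC n m),
      ((∃ (i : Fin n) (j : Fin m),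
          y = -(colIdx (n := n) j) ∧ z = zIdx (m := m) i ∧ l i j = true) →
        ((bprod l)⁻¹ ((topI (by omega), y, z), Dir.xp)).2 = Dir.zp) ∧
      (¬(∃ (i : Fin n) (j : Fin m),
          y = -(colIdx (n := n) j) ∧ z = zIdx (m := m) i ∧ l i j = true) →
        (∃ i : Fin n, z = zIdx (m := m) i) →
        ((bprod l)⁻¹ ((topI (by omega), y, z), Dir.xp)).2 = Dir.yp) ∧
      (¬(∃ (i : Fin n) (j : Fin m),
          y = -(colIdx (n := n) j) ∧ z = zIdx (m := m) i ∧ l i j = true) →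
        ¬(∃ i : Fin n, z = zIdx (m := m) i) →
        ((bprod l)⁻¹ ((topI (by omega), y, z), Dir.xp)).2 = Dir.xp)) ∧
    (∀ y z : I (hC n m),
      ((∃ (i : Fin n) (j : Fin m),
          y = -(colIdx (n := n) j) ∧ z = zIdx (m := m) i ∧ l i j = true) →
        ((bprod l)⁻¹ ((-(topI (by omega)), y, z), Dir.xn)).2 = Dir.zn) ∧
      (¬(∃ (i : Fin n) (j : Fin m),
          y = -(colIdx (n := n) j) ∧ z = zIdx (m := m) i ∧ l i j = true) →
        (∃ i : Fin n, z = zIdx (m := m) i) →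
        ((bprod l)⁻¹ ((-(topI (by omega)), y, z), Dir.xn)).2 = Dir.yn) ∧
      (¬(∃ (i : Fin n) (j : Fin m),
          y = -(colIdx (n := n) j) ∧ z = zIdx (m := m) i ∧ l i j = true) →
        ¬(∃ i : Fin n, z = zIdx (m := m) i) →
        ((bprod l)⁻¹ ((-(topI (by omega)), y, z), Dir.xn)).2 = Dir.xn)) := by
  have hlt (i : Fin n) : ((i : ℕ) : ℤ) < n := by exact_mod_cast i.isLt
  have hne (i k : Fin n) (hk : k ≠ i) : ((k : ℕ) : ℤ) ≠ i := by
    exact_mod_cast fun h => hk (Fin.ext h)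
  have hbt (k : Fin n) : bit (l k) (topI (n := n) (m := m) (by omega)).1 = false :=
    bit_eq_false _ (by simp only [topI_val]; omega)
  have hbn (k : Fin n) : bit (l k) (-(topI (n := n) (m := m) (by omega))).1 = false :=
    bit_eq_false _ (by simp only [I.neg_val, topI_val]; omega)
  have htop (k : Fin n) : (m : ℤ) + 3 * n ≠ m + ((k : ℕ) : ℤ) + 1 := by have := hlt k; omega
  have hbot (k : Fin n) : -((m : ℤ) + 3 * n) ≠ m + ((k : ℕ) : ℤ) + 1 := by omega
  have hbitj (i : Fin n) (j : Fin m) (h : l i j = true) :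
      bit (l i) (colIdx (n := n) j).1 = true := (bit_eq_true_iff _ _).2 ⟨j, rfl, h⟩
  have hz (i k : Fin n) (hk : k ≠ i) :
      (zIdx (m := m) i).1 ≠ (m : ℤ) + ((k : ℕ) : ℤ) + 1 := by
    have := hne i k hk
    simp only [zIdx_val]
    omega
  have hnz (i k : Fin n) (hk : k ≠ i) :
      -(-(zIdx (m := m) i)).1 ≠ (m : ℤ) + ((k : ℕ) : ℤ) + 1 := by
    have := hz i k hk
    simpa only [I.neg_val, neg_neg] using this
  refine ⟨fun x y => ⟨?_, ?_⟩, fun x y => ⟨?_, ?_⟩, fun x z => ⟨?_, ?_⟩, fun x z => ⟨?_, ?_⟩,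
    fun y z => ⟨?_, ?_, ?_⟩, fun y z => ⟨?_, ?_, ?_⟩⟩
  · rintro ⟨i, j, rfl, rfl, hl⟩
    rw [bprod_inv_apply i ((-(topI (by omega)), colIdx j, zIdx i), Dir.xn)]
    · simp [a_apply, Z_apply, hbn, hbitj i j hl, -I.neg_val, -colIdx_val, rotX, rotZ]
    · exact fun k hk => avoids_of (fun _ => hnz i k hk) fun _ => htop k
    · exact fun k hk => avoids_of (fun h => by simp [hbn, -I.neg_val] at h) fun _ => hz i k hk
  · intro hno
    rw [bprod_inv_apply_of_avoids]
    refine fun k => avoids_of (fun h hy => ?_) fun _ => htop k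
    obtain ⟨j, hx, hl⟩ := (bit_eq_true_iff _ _).1 h
    exact hno ⟨k, j, hx, I.ext_val.2 (by simp only [I.neg_val, zIdx_val]; omega), hl⟩
  · rintro ⟨i, j, rfl, rfl, hl⟩
    rw [bprod_inv_apply i ((topI (by omega), colIdx j, zIdx i), Dir.xp)]
    · simp [a_apply, Z_apply, hbt, hbitj i j hl, -topI_val, -colIdx_val, rotX, rotZ]
    · exact fun k hk => avoids_of (fun _ => hnz i k hk) fun _ => hbot k
    · exact fun k hk => avoids_of (fun h => by simp [hbt, -topI_val] at h) fun _ => hz i k hk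
  · intro hno
    rw [bprod_inv_apply_of_avoids]
    refine fun k => avoids_of (fun h hy => ?_) fun _ => hbot k
    obtain ⟨j, hx, hl⟩ := (bit_eq_true_iff _ _).1 h
    exact hno ⟨k, j, hx, I.ext_val.2 (by simp only [I.neg_val, zIdx_val]; omega), hl⟩
  · rintro ⟨i, rfl, hb⟩
    rw [bprod_inv_apply i ((-(topI (by omega)), x, zIdx i), Dir.xn)]
    · simp [a_apply, Z_apply, hbn, hb, -I.neg_val, rotZ]
    · exact fun k hk => avoids_of (fun _ => hbot k) fun _ => hz i k hk
    · exact fun k hk => avoids_of (fun h => by simp [hbn, -I.neg_val] at h) fun _ => hz i k hk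
  · intro hno
    rw [bprod_inv_apply_of_avoids]
    exact fun k => avoids_of (fun _ => hbot k) fun hb h => hno ⟨k, I.ext_val.2 h, hb⟩
  · rintro ⟨i, rfl, hb⟩
    rw [bprod_inv_apply i ((topI (by omega), x, zIdx i), Dir.xp)]
    · simp [a_apply, Z_apply, hbt, hb, -topI_val, rotZ]
    · exact fun k hk => avoids_of (fun _ => by simpa using htop k) fun _ => hz i k hk
    · exact fun k hk => avoids_of (fun h => by simp [hbt, -topI_val] at h) fun _ => hz i k hk
  · intro hno
    rw [bprod_inv_apply_of_avoids]
    exact fun k => avoids_of (fun _ => by simpa using htop k) fun hb h =>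
      hno ⟨k, I.ext_val.2 h, hb⟩
  · rintro ⟨i, j, rfl, rfl, hl⟩
    rw [bprod_inv_apply i ((colIdx j, -(zIdx i), topI (by omega)), Dir.zp)]
    · simp [a_apply, Z_apply, hbt, hbitj i j hl, -topI_val, -colIdx_val, rotX, rotZ]
    · exact fun k hk => avoids_of (fun h => by simp [hbt, -topI_val] at h) fun _ => hz i k hk
    · exact fun k hk => avoids_of (fun _ => hnz i k hk) fun _ => htop k
  · rintro hno ⟨i, rfl⟩
    have hb : ¬bit (l i) (-y).1 = true := fun h => by
      obtain ⟨j, hy, hl⟩ := (bit_eq_true_iff _ _).1 h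
      exact hno ⟨i, j, by rw [← hy, I.neg_neg], rfl, hl⟩
    rw [bprod_inv_apply i ((-y, topI (by omega), zIdx i), Dir.yp)]
    · simp [a_apply, Z_apply, hbt, hb, -topI_val, -I.neg_val, rotZ]
    · exact fun k hk => avoids_of (fun h => by simp [hbt, -topI_val] at h) fun _ => hz i k hk
    · exact fun k hk => avoids_of (fun _ => hbot k) fun _ => hz i k hk
  · intro _ hno
    rw [bprod_inv_apply_of_avoids]
    exact fun k => avoids_of (fun h => by simp [hbt, -topI_val] at h) fun _ h =>
      hno ⟨k, I.ext_val.2 h⟩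
  · rintro ⟨i, j, rfl, rfl, hl⟩
    rw [bprod_inv_apply i ((colIdx j, -(zIdx i), -(topI (by omega))), Dir.zn)]
    · simp [a_apply, Z_apply, hbn, hbitj i j hl, -I.neg_val, -colIdx_val, rotX, rotZ]
    · exact fun k hk => avoids_of (fun h => by simp [hbn, -I.neg_val] at h) fun _ => hz i k hk
    · exact fun k hk => avoids_of (fun _ => hnz i k hk) fun _ => hbot k
  · rintro hno ⟨i, rfl⟩
    have hb : ¬bit (l i) (-y).1 = true := fun h => by
      obtain ⟨j, hy, hl⟩ := (bit_eq_true_iff _ _).1 h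
      exact hno ⟨i, j, by rw [← hy, I.neg_neg], rfl, hl⟩
    rw [bprod_inv_apply i ((-y, -(topI (by omega)), zIdx i), Dir.yn)]
    · simp [a_apply, Z_apply, hbn, hb, -I.neg_val, rotZ]
    · exact fun k hk => avoids_of (fun h => by simp [hbn, -I.neg_val] at h) fun _ => hz i k hk
    · exact fun k hk => avoids_of (fun _ => by simpa using htop k) fun _ => hz i k hk
  · intro _ hno
    rw [bprod_inv_apply_of_avoids]
    exact fun k => avoids_of (fun h => by simp [hbn, -I.neg_val] at h) fun _ h =>
      hno ⟨k, I.ext_val.2 h⟩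

end RC
end

section
/- Suppose the bitstrings l₁, …, lₙ are pairwise distinct and lₙ is the all-zeros bitstring. Suppose g₁, …, g_{k′} with k′ ≤ 2n − 1 are STM moves such that in the configuration (g_{k′} ⋯ g₁ · t)(C₀) every face is monochromatic, i.e. for each direction d the map sending each surface slot p with direction d to the direction component of (g_{k′} ⋯ g₁ · t)⁻¹(p) is constant. Then for every i ∈ {1, …, n} there exists j ∈ {1, …, k′} such that g_j is an index-(m+i) move. -/
namespace RC

/-- The two coordinates lying in a face have absolute values `w` and `u`, in some order. -/
def AbsPair {h : ℕ} (w u : ℤ) (x y : I h) : Prop :=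
  (|x.1| = w ∧ |y.1| = u) ∨ (|x.1| = u ∧ |y.1| = w)

/-- The surface slots of the face `d` whose coordinates in the face are `±w` and `±u`. -/
def FaceOrbit {h : ℕ} (w u : ℤ) (d : Dir) (s : S h) : Prop :=
  s.2 = d ∧ IsSurface s ∧
    match d with
    | .xp | .xn => AbsPair w u s.1.2.1 s.1.2.2
    | .yp | .yn => AbsPair w u s.1.1 s.1.2.2
    | .zp | .zn => AbsPair w u s.1.1 s.1.2.1

theorem I.abs_neg {h : ℕ} (x : I h) : |(-x).1| = |x.1| :=
  _root_.abs_neg x.1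

theorem AbsPair.left_ne {h : ℕ} {w u : ℤ} {x y v : I h} (hxy : AbsPair w u x y)
    (hw : |v.1| ≠ w) (hu : |v.1| ≠ u) : x ≠ v := by
  rintro rfl
  rcases hxy with ⟨h₁, -⟩ | ⟨h₁, -⟩
  exacts [hw h₁, hu h₁]

theorem AbsPair.symm {h : ℕ} {w u : ℤ} {x y : I h} (hxy : AbsPair w u x y) :
    AbsPair w u y x :=
  hxy.elim (fun h' => .inr h'.symm) (fun h' => .inl h'.symm)

theorem AbsPair.right_ne {h : ℕ} {w u : ℤ} {x y v : I h} (hxy : AbsPair w u x y)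
    (hw : |v.1| ≠ w) (hu : |v.1| ≠ u) : y ≠ v :=
  hxy.symm.left_ne hw hu

theorem AbsPair.neg_left {h : ℕ} {w u : ℤ} {x y : I h} (hxy : AbsPair w u x y) :
    AbsPair w u (-x) y := by
  simpa only [AbsPair, I.abs_neg] using hxy

theorem AbsPair.neg_right {h : ℕ} {w u : ℤ} {x y : I h} (hxy : AbsPair w u x y) :
    AbsPair w u x (-y) :=
  hxy.symm.neg_left.symm

theorem Y_apply_of_ne {h : ℕ} {v : I h} {s : S h} (hs : s.1.2.1 ≠ v) : Y v s = s :=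
  if_neg hs

theorem FaceOrbit.apply_X {h : ℕ} {w u : ℤ} {d : Dir} {s : S h} {v : I h}
    (hw : |v.1| ≠ w) (hu : |v.1| ≠ u) (hs : FaceOrbit w u d s) : FaceOrbit w u d (X v s) := by
  by_cases hv : s.1.1 = v
  · have e : X v s = ((s.1.1, s.1.2.2, -s.1.2.1), rotX s.2) := if_pos hv
    obtain ⟨⟨x, y, z⟩, c⟩ := s
    obtain ⟨rfl, hsurf, hp⟩ := hs
    rw [e]
    cases c
    case xp | xn => exact ⟨rfl, hsurf, hp.symm.neg_right⟩
    all_goals exact absurd hv (hp.left_ne hw hu)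
  · rwa [X_apply_of_ne hv]

theorem FaceOrbit.apply_Y {h : ℕ} {w u : ℤ} {d : Dir} {s : S h} {v : I h}
    (hw : |v.1| ≠ w) (hu : |v.1| ≠ u) (hs : FaceOrbit w u d s) : FaceOrbit w u d (Y v s) := by
  by_cases hv : s.1.2.1 = v
  · have e : Y v s = ((-s.1.2.2, s.1.2.1, s.1.1), rotY s.2) := if_pos hv
    obtain ⟨⟨x, y, z⟩, c⟩ := s
    obtain ⟨rfl, hsurf, hp⟩ := hs
    rw [e]
    cases c
    case yp | yn => exact ⟨rfl, hsurf, hp.symm.neg_left⟩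
    case xp | xn => exact absurd hv (hp.left_ne hw hu)
    case zp | zn => exact absurd hv (hp.right_ne hw hu)
  · rwa [Y_apply_of_ne hv]

theorem FaceOrbit.apply_Z {h : ℕ} {w u : ℤ} {d : Dir} {s : S h} {v : I h}
    (hw : |v.1| ≠ w) (hu : |v.1| ≠ u) (hs : FaceOrbit w u d s) : FaceOrbit w u d (Z v s) := by
  by_cases hv : s.1.2.2 = v
  · have e : Z v s = ((s.1.2.1, -s.1.1, s.1.2.2), rotZ s.2) := if_pos hv
    obtain ⟨⟨x, y, z⟩, c⟩ := s
    obtain ⟨rfl, hsurf, hp⟩ := hs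
    rw [e]
    cases c
    case zp | zn => exact ⟨rfl, hsurf, hp.symm.neg_right⟩
    all_goals exact absurd hv (hp.right_ne hw hu)
  · rwa [Z_apply_of_ne hv]

theorem list_prod_apply_of_forall {α : Type*} {p : α → Prop} (L : List (Equiv.Perm α))
    (hL : ∀ f ∈ L, ∀ s, p s → p (f s)) {s : α} (hs : p s) : p (L.prod s) := by
  induction L with
  | nil => simpa using hs
  | cons f L ih =>
    rw [List.prod_cons, Equiv.Perm.mul_apply]
    exact hL f (by simp) _ (ih fun f' hf' => hL f' (by simp [hf']))

theorem pow_apply_of_forall {α : Type*} {p : α → Prop} {f : Equiv.Perm α}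
    (hf : ∀ s, p s → p (f s)) (e : ℕ) {s : α} (hs : p s) : p ((f ^ e) s) := by
  rw [← List.prod_replicate]
  exact list_prod_apply_of_forall _ (fun f' hf' => List.eq_of_mem_replicate hf' ▸ hf) hs

/-- A product over a duplicate-free list maps `s` to `s'` if one factor does so and the other
factors fix both points. -/
theorem list_map_prod_apply {ι α : Type*} (f : ι → Equiv.Perm α) {i : ι} {s s' : α}
    (hi : f i s = s') (hs : ∀ j, j ≠ i → f j s = s) (hs' : ∀ j, j ≠ i → f j s' = s')
    {L : List ι} (hL : L.Nodup) (hmem : i ∈ L) : (L.map f).prod s = s' := by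
  induction L with
  | nil => simp at hmem
  | cons j L ih =>
    rw [List.nodup_cons] at hL
    rw [List.map_cons, List.prod_cons, Equiv.Perm.mul_apply]
    by_cases hj : j = i
    · subst hj
      rw [list_prod_apply_of_forall (p := (· = s)) (L.map f) _ rfl, hi]
      intro f' hf' r hr
      obtain ⟨k, hk, rfl⟩ := List.mem_map.1 hf'
      rw [hr]
      exact hs k fun hkj => hL.1 (hkj ▸ hk)
    · rw [ih hL.2 ((List.mem_cons.1 hmem).resolve_left fun h' => hj h'.symm), hs' j hj]

/-- `aᵢ` only moves slots with `x`-coordinate in `{1, …, m}`. -/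
theorem a_apply_of_outside {n m : ℕ} (l : Fin n → Fin m → Bool) (i : Fin n) {s : S (hC n m)}
    (hs : s.1.1.1 < 1 ∨ (m : ℤ) < s.1.1.1) : a l i s = s := by
  refine list_prod_apply_of_forall (p := (· = s)) _ ?_ rfl
  intro f hf r hr
  obtain ⟨j, -, rfl⟩ := List.mem_map.1 hf
  refine pow_apply_of_forall (p := (· = s)) ?_ _ hr
  rintro _ rfl
  refine X_apply_of_ne fun h' => ?_
  have h₁ := congrArg Subtype.val h'
  change _ = ((j : ℕ) : ℤ) + 1 at h₁
  have := j.isLt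
  omega

/-- On slots that the `aᵢ` do not touch, `bᵢ` acts as the slice turn `Z (m+i)`. -/
theorem b_apply_of_outside {n m : ℕ} (l : Fin n → Fin m → Bool) (i : Fin n) {s s' : S (hC n m)}
    (hZ : Z (zIdx i) s = s') (hs : s.1.1.1 < 1 ∨ (m : ℤ) < s.1.1.1)
    (hs' : s'.1.1.1 < 1 ∨ (m : ℤ) < s'.1.1.1) : b l i s = s' := by
  rw [b, Equiv.Perm.mul_apply, Equiv.Perm.mul_apply, a_apply_of_outside l i hs, hZ,
    Equiv.Perm.inv_eq_iff_eq, a_apply_of_outside l i hs']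

theorem zIdx_injective {n m : ℕ} : Function.Injective (zIdx (n := n) (m := m)) := by
  intro i j hij
  have h₁ := congrArg Subtype.val hij
  change (m : ℤ) + ((i : ℕ) : ℤ) + 1 = (m : ℤ) + ((j : ℕ) : ℤ) + 1 at h₁
  ext
  omega

theorem t_apply_of_slice {n m : ℕ} (hn : 0 < n) (l : Fin n → Fin m → Bool) (i : Fin n)
    {s s' : S (hC n m)} (hZ : Z (zIdx i) s = s')
    (hz : s.1.2.2 = zIdx i) (hz' : s'.1.2.2 = zIdx i)
    (hs : s.1.1.1 < 1 ∨ (m : ℤ) < s.1.1.1)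
    (hs' : s'.1.1.1 < 1 ∨ (m : ℤ) < s'.1.1.1) : t hn l s = s' := by
  have hfix : ∀ (r : S (hC n m)), r.1.2.2 = zIdx i → (r.1.1.1 < 1 ∨ (m : ℤ) < r.1.1.1) →
      ∀ j, j ≠ i → b l j r = r := fun r hr hr' j hj =>
    b_apply_of_outside l j
      (Z_apply_of_ne fun h' => hj (zIdx_injective (h'.symm.trans hr))) hr' hr'
  rw [t, Equiv.Perm.mul_apply, list_map_prod_apply (b l) (b_apply_of_outside l i hZ hs hs')
    (hfix s hz hs) (hfix s' hz' hs') (List.nodup_finRange n) (List.mem_finRange i),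
    a_apply_of_outside l _ hs']

theorem t_apply_of_neg {n m : ℕ} (hn : 0 < n) (l : Fin n → Fin m → Bool)
    {s : S (hC n m)} (hz : s.1.2.2.1 < 0)
    (hs : s.1.1.1 < 1 ∨ (m : ℤ) < s.1.1.1) : t hn l s = s := by
  rw [t, Equiv.Perm.mul_apply, list_prod_apply_of_forall (p := (· = s)) _ _ rfl,
    a_apply_of_outside l _ hs]
  intro f hf r hr
  obtain ⟨j, -, rfl⟩ := List.mem_map.1 hf
  rw [hr]
  refine b_apply_of_outside l j (Z_apply_of_ne fun h' => ?_) hs hs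
  have h₁ := congrArg Subtype.val h'
  change _ = (m : ℤ) + ((j : ℕ) : ℤ) + 1 at h₁
  omega

/-- if a ≤ 2n−1 STM move sequence makes every face monochromatic, then for
every `i ∈ {1, …, n}` some move of the sequence is an index-`(m+i)` move. -/
theorem stmt_19 (n m : ℕ) (hn : 0 < n) (hm : 0 < m) (l : Fin n → Fin m → Bool)
    (hdist : Function.Injective l)
    (hlast : l ⟨n - 1, by omega⟩ = fun _ => false)
    (k' : ℕ) (hk : k' ≤ 2 * n - 1) (g : Fin k' → Equiv.Perm (S (hC n m)))
    (hSTM : ∀ q, IsSTM (g q))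
    (hmono : ∀ d : Dir, ∃ d₀ : Dir, ∀ p : S (hC n m), IsSurface p → p.2 = d →
      (((List.ofFn g).reverse.prod * t hn l)⁻¹ p).2 = d₀) :
    ∀ i : Fin n, ∃ (q : Fin k') (v : I (hC n m)) (e : ℕ),
      (e = 1 ∨ e = 2 ∨ e = 3) ∧ |v.1| = (m : ℤ) + ((i : ℕ) : ℤ) + 1 ∧
      (g q = X v ^ e ∨ g q = Y v ^ e ∨ g q = Z v ^ e) := by
  intro i
  by_contra! hno
  choose v e he hg using hSTM
  set w : ℤ := (m : ℤ) + ((i : ℕ) : ℤ) + 1 with hw_def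
  have hw : ∀ q, |(v q).1| ≠ w := fun q hq => by
    obtain ⟨hX, hY, hZ⟩ := hno q (v q) (e q) (he q) hq
    exact (hg q).elim hX fun h' => h'.elim hY hZ
  have hcard : (Finset.univ.image fun q => |(v q).1|).card <
      (Finset.Icc ((m : ℤ) + n + 1) (m + 3 * n)).card := by
    refine Finset.card_image_le.trans_lt ?_
    rw [Finset.card_univ, Fintype.card_fin, Int.card_Icc]
    omega
  obtain ⟨u, hu_mem, hu_notMem⟩ := Finset.exists_mem_notMem_of_card_lt_card hcard
  rw [Finset.mem_Icc] at hu_mem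
  have hu : ∀ q, |(v q).1| ≠ u := fun q hq =>
    hu_notMem (Finset.mem_image.2 ⟨q, Finset.mem_univ q, hq⟩)
  have horbit : ∀ s, FaceOrbit w u .yp s → FaceOrbit w u .yp ((List.ofFn g).reverse.prod s) := by
    refine fun s hs => list_prod_apply_of_forall _ (fun f hf r hr => ?_) hs
    rw [List.mem_reverse, List.mem_ofFn] at hf
    obtain ⟨q, rfl⟩ := hf
    rcases hg q with h' | h' | h' <;> rw [h']
    · exact pow_apply_of_forall (p := FaceOrbit w u .yp)
        (fun _ => FaceOrbit.apply_X (hw q) (hu q)) _ hr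
    · exact pow_apply_of_forall (p := FaceOrbit w u .yp)
        (fun _ => FaceOrbit.apply_Y (hw q) (hu q)) _ hr
    · exact pow_apply_of_forall (p := FaceOrbit w u .yp)
        (fun _ => FaceOrbit.apply_Z (hw q) (hu q)) _ hr
  obtain ⟨d₀, hd₀⟩ := hmono .yp
  have hcolor : ∀ s p, t hn l s = p → FaceOrbit w u .yp p → s.2 = d₀ := fun s p hsp hp => by
    have := hd₀ _ (horbit p hp).2.1 (horbit p hp).1
    rwa [mul_inv_rev, Equiv.Perm.mul_apply, Equiv.Perm.inv_eq_iff_eq.2 rfl,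
      Equiv.Perm.inv_eq_iff_eq.2 hsp.symm] at this
  have hu_pos : 0 < u := by omega
  let U : I (hC n m) := ⟨u, by omega, by rw [abs_of_pos hu_pos]; push_cast; omega⟩
  let T : I (hC n m) := topI (by omega)
  have hTval : T.1 = (m : ℤ) + 3 * n := rfl
  have hUabs : |U.1| = u := abs_of_pos hu_pos
  have hWabs : |(zIdx (m := m) i).1| = w := abs_of_pos (show 0 < w by omega)
  have hsurf : ∀ z : I (hC n m), IsSurface (((U, T, z), .yp) : S (hC n m)) := fun z => by
    change T.1 = _
    rw [hTval]
    push_cast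
    rfl
  have hrot : t hn l ((-T, U, zIdx i), .xn) = ((U, T, zIdx i), .yp) := by
    refine t_apply_of_slice hn l i ?_ rfl rfl (.inl ?_) (.inr ?_)
    · exact (if_pos rfl).trans (by simp [rotZ])
    · change -T.1 < 1
      omega
    · change (m : ℤ) < u
      omega
  have hfix : t hn l ((U, T, -zIdx i), .yp) = ((U, T, -zIdx i), .yp) := by
    refine t_apply_of_neg hn l ?_ (.inr ?_)
    · change -w < 0
      omega
    · change (m : ℤ) < u
      omega
  have h₁ := hcolor _ _ hrot ⟨rfl, hsurf _, .inr ⟨hUabs, hWabs⟩⟩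
  have h₂ := hcolor _ _ hfix ⟨rfl, hsurf _, .inr ⟨hUabs, (I.abs_neg _).trans hWabs⟩⟩
  exact Dir.noConfusion (h₁.trans h₂.symm)

end RC
end
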